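/- Let k be a field, Γ a finite simple graph on {1,…,n} with clique complex K, d ≥ 0, and suppose the Cartan complex (k⟨K⟩ ⊗_k S, ω) of K has vanishing cohomology H^p = 0 for all p ≠ d+1 (this holds if and only if K is Cohen–Macaulay of dimension d); set F_K = H^{d+1}(k⟨K⟩ ⊗_k S, ω). Regard the Laurent polynomial ring k[ℤ^n] = k[y_1^{±1},…,y_n^{±1}] (the group algebra of the abelianization of G_Γ) as an S-module via t_i ↦ y_i − 1, and as a G_Γ-module via the abelianization map (v_i acting by multiplication by y_i). Then H^q(G_Γ; k[ℤ^n]) = 0 for all q ≠ d+1, and H^{d+1}(G_Γ; k[ℤ^n]) ≅ F_K ⊗_S k[ℤ^n], the localization of F_K inverting the elements t_1+1, …, t_n+1. -/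

import Mathlib

attribute [local instance] Classical.propDecidable

noncomputable section

open CategoryTheory

/-! ### Right-angled Artin groups -/

/-- The defining relators of a right-angled Artin group. -/
def raagRels {n : ℕ} (G : SimpleGraph (Fin n)) : Set (FreeGroup (Fin n)) :=
  {r | ∃ i j : Fin n, G.Adj i j ∧
    r = FreeGroup.of i * FreeGroup.of j * (FreeGroup.of i)⁻¹ * (FreeGroup.of j)⁻¹}

/-- The right-angled Artin group of a finite simple graph on `Fin n`. -/
abbrev RAAG {n : ℕ} (G : SimpleGraph (Fin n)) : Type :=
  PresentedGroup (raagRels G)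

/-- The clique complex of a graph. -/
def cliqueComplex {n : ℕ} (Γ : SimpleGraph (Fin n)) : Set (Finset (Fin n)) :=
  {σ | ∀ i ∈ σ, ∀ j ∈ σ, i ≠ j → Γ.Adj i j}

/-! ### Group cohomology with coefficients in `k[ℤᵐ]` -/

/-- The group algebra `k[ℤᵐ]` of Laurent polynomials. -/
abbrev LaurentRing (k : Type) [CommRing k] (m : ℕ) : Type :=
  AddMonoidAlgebra k (Fin m → ℤ)

/-- Multiplication by the monomial `y^v` on the Laurent ring. -/
def yMul (k : Type) [CommRing k] (m : ℕ) (v : Fin m → ℤ) :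
    LaurentRing k m →ₗ[LaurentRing k m] LaurentRing k m :=
  LinearMap.mulLeft (LaurentRing k m) (AddMonoidAlgebra.single v 1)

/-- The space of inhomogeneous `q`-cochains of `G` with values in `k[ℤᵐ]`. -/
abbrev inhomogCochains (k : Type) [CommRing k] (m : ℕ) (G : Type) (q : ℕ) : Type :=
  (Fin q → G) → LaurentRing k m

variable (k : Type) [Field k] {m : ℕ} {G : Type} [Group G]
  (φ : G →* Multiplicative (Fin m → ℤ))

/-- The differential of the inhomogeneous cochain complex computing group
cohomology, where `g ∈ G` acts on `k[ℤᵐ]` by multiplication by `y^{φ g}`. -/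
def inhomogCoD (q : ℕ) :
    inhomogCochains k m G q →ₗ[LaurentRing k m] inhomogCochains k m G (q + 1) :=
  LinearMap.pi fun g : Fin (q + 1) → G =>
    (yMul k m (Multiplicative.toAdd (φ (g 0)))).comp
        (LinearMap.proj (fun i => g i.succ)) +
    ∑ j : Fin (q + 1),
      ((-1 : ℤ) ^ ((j : ℕ) + 1)) • LinearMap.proj (Fin.contractNth j (· * ·) g)

/-- The cochain differential entering degree `q` (zero for `q = 0`). -/
def inhomogCoDpre : ∀ q : ℕ,
    inhomogCochains k m G (q - 1) →ₗ[LaurentRing k m] inhomogCochains k m G q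
  | 0 => 0
  | (q + 1) => inhomogCoD k φ q

/-- The group cohomology `H^q(G; k[ℤᵐ])`. -/
def groupCohomologyLaurent (q : ℕ) : Type :=
  ↥(Submodule.map (LinearMap.range (inhomogCoDpre k φ q)).mkQ
      (LinearMap.ker (inhomogCoD k φ q)))

instance (q : ℕ) : AddCommGroup (groupCohomologyLaurent k φ q) :=
  inferInstanceAs (AddCommGroup ↥(Submodule.map _ _))

instance (q : ℕ) : Module (LaurentRing k m) (groupCohomologyLaurent k φ q) :=
  inferInstanceAs (Module _ ↥(Submodule.map _ _))

/-! ### The polynomial ring `S` and the Cartan complex -/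

/-- The polynomial ring `S = k[t₁,…,tₙ]`. -/
abbrev polyRing (k : Type) [Field k] (n : ℕ) : Type := MvPolynomial (Fin n) k

/-- The ring homomorphism `S → k[ℤᵐ]`, `tᵢ ↦ y_{f i} - 1`. -/
def phiS (k : Type) [Field k] {n m : ℕ} (f : Fin n → Fin m) :
    polyRing k n →+* LaurentRing k m :=
  (MvPolynomial.eval₂Hom (algebraMap k (LaurentRing k m))
    (fun i => AddMonoidAlgebra.single (Pi.single (f i) 1) 1 - 1))

variable {n : ℕ} (K : Set (Finset (Fin n)))

/-- The degree-`p` term `k⟨K⟩_p ⊗_k S` of the Cartan complex. -/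
abbrev cartanTerm (p : ℕ) : Type :=
  {I : Finset (Fin n) // I ∈ K ∧ I.card = p} → polyRing k n

/-- The Cartan differential, left multiplication by `ω = ∑ eᵢ ⊗ tᵢ`. -/
def cartanD (p : ℕ) : cartanTerm k K p →ₗ[polyRing k n] cartanTerm k K (p + 1) :=
  LinearMap.pi fun J => ∑ i : Fin n,
    if h : i ∈ J.1 ∧ J.1.erase i ∈ K then
      ((-1 : ℤ) ^ (J.1.filter (· < i)).card) •
        ((LinearMap.mulLeft (polyRing k n) (MvPolynomial.X i)).comp
          (LinearMap.proj
            (⟨J.1.erase i, h.2, by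
                rw [Finset.card_erase_of_mem h.1, J.2.2, Nat.add_sub_cancel]⟩ :
              {I : Finset (Fin n) // I ∈ K ∧ I.card = p})))
    else 0

/-- The Cartan differential entering degree `p` (zero for `p = 0`). -/
def cartanDpre : ∀ p : ℕ, cartanTerm k K (p - 1) →ₗ[polyRing k n] cartanTerm k K p
  | 0 => 0
  | (p + 1) => cartanD k K p

/-- The `p`-th cohomology of the Cartan complex `(k⟨K⟩ ⊗_k S, ω)`. -/
def cartanCohomology (p : ℕ) : Type :=
  ↥(Submodule.map (LinearMap.range (cartanDpre k K p)).mkQ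
      (LinearMap.ker (cartanD k K p)))

instance (p : ℕ) : AddCommGroup (cartanCohomology k K p) :=
  inferInstanceAs (AddCommGroup ↥(Submodule.map _ _))

instance (p : ℕ) : Module (polyRing k n) (cartanCohomology k K p) :=
  inferInstanceAs (Module _ ↥(Submodule.map _ _))

/-- The algebra structure on `k[ℤⁿ]` over `S = k[t₁,…,tₙ]` in which
`tᵢ ↦ yᵢ - 1`; this realizes `k[ℤⁿ]` as the localization of `S` inverting
`t₁ + 1, …, tₙ + 1`. -/
instance (k : Type) [Field k] {n : ℕ} :
    Algebra (polyRing k n) (LaurentRing k n) :=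
  (phiS k (id : Fin n → Fin n)).toAlgebra

/-! ### Subquotients of modules -/

section Subquotient

variable {R X Y W : Type} [Ring R] [AddCommGroup X] [Module R X] [AddCommGroup Y] [Module R Y]
  [AddCommGroup W] [Module R W]

/-- The image of `Z` in the quotient by `B`; this is `Z / B` when `B ≤ Z`. -/
abbrev Subquotient (B Z : Submodule R X) : Type := ↥(Submodule.map B.mkQ Z)

/-- A module mapping compatibly to two subquotients, onto both and with the same kernels,
identifies them. -/
theorem Subquotient.nonempty_equiv {BX ZX : Submodule R X} {BY ZY : Submodule R Y}
    (p : W →ₗ[R] X) (r : W →ₗ[R] Y) (hp : ∀ w, p w ∈ ZX) (hr : ∀ w, r w ∈ ZY)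
    (hpZ : ∀ z ∈ ZX, ∃ w, p w - z ∈ BX) (hrZ : ∀ z ∈ ZY, ∃ w, r w - z ∈ BY)
    (hpr : ∀ w, p w ∈ BX ↔ r w ∈ BY) :
    Nonempty (Subquotient BX ZX ≃ₗ[R] Subquotient BY ZY) := by
  let p' : W →ₗ[R] Subquotient BX ZX :=
    (BX.mkQ ∘ₗ p).codRestrict _ fun w => Submodule.mem_map_of_mem (hp w)
  let r' : W →ₗ[R] Subquotient BY ZY :=
    (BY.mkQ ∘ₗ r).codRestrict _ fun w => Submodule.mem_map_of_mem (hr w)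
  have hp' : Function.Surjective p' := by
    rintro ⟨_, z, hz, rfl⟩
    obtain ⟨w, hw⟩ := hpZ z hz
    exact ⟨w, Subtype.ext ((Submodule.Quotient.eq BX).2 hw)⟩
  have hr' : Function.Surjective r' := by
    rintro ⟨_, z, hz, rfl⟩
    obtain ⟨w, hw⟩ := hrZ z hz
    exact ⟨w, Subtype.ext ((Submodule.Quotient.eq BY).2 hw)⟩
  have hker : LinearMap.ker p' = LinearMap.ker r' := by
    ext w
    have h1 : p' w = 0 ↔ p w ∈ BX := by
      rw [← Submodule.Quotient.mk_eq_zero BX, ← Subtype.coe_inj]; rfl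
    have h2 : r' w = 0 ↔ r w ∈ BY := by
      rw [← Submodule.Quotient.mk_eq_zero BY, ← Subtype.coe_inj]; rfl
    rw [LinearMap.mem_ker, LinearMap.mem_ker, h1, h2, hpr]
  exact ⟨(p'.quotKerEquivOfSurjective hp').symm ≪≫ₗ Submodule.quotEquivOfEq _ _ hker ≪≫ₗ
    r'.quotKerEquivOfSurjective hr'⟩

end Subquotient

/-! ### Dimension shifting -/

section DimensionShift

variable {R M I Q : Type} [Ring R] [AddCommGroup M] [Module R M] [AddCommGroup I] [Module R I]
  [AddCommGroup Q] [Module R Q] {ι₀ ι₁ ι₂ ι₃ : Type}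

/-- The connecting isomorphism `H^q(Q) ≃ H^{q+1}(M)` for a short exact sequence
`0 → M → I → Q → 0` of coefficients, when the complex with coefficients in `I` is exact in degrees
`q` and `q + 1`. -/
theorem nonempty_equiv_of_exact (i : M →ₗ[R] I) (π : I →ₗ[R] Q) (hi : Function.Injective i)
    (hπ : Function.Surjective π) (hex : ∀ x, π x = 0 ↔ x ∈ LinearMap.range i)
    (dM₁ : (ι₁ → M) →ₗ[R] (ι₂ → M)) (dM₂ : (ι₂ → M) →ₗ[R] (ι₃ → M))
    (dI₀ : (ι₀ → I) →ₗ[R] (ι₁ → I)) (dI₁ : (ι₁ → I) →ₗ[R] (ι₂ → I))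
    (dI₂ : (ι₂ → I) →ₗ[R] (ι₃ → I))
    (dQ₀ : (ι₀ → Q) →ₗ[R] (ι₁ → Q)) (dQ₁ : (ι₁ → Q) →ₗ[R] (ι₂ → Q))
    (hi₁ : ∀ u, dI₁ (i ∘ u) = i ∘ dM₁ u) (hi₂ : ∀ u, dI₂ (i ∘ u) = i ∘ dM₂ u)
    (hπ₀ : ∀ u, dQ₀ (π ∘ u) = π ∘ dI₀ u) (hπ₁ : ∀ u, dQ₁ (π ∘ u) = π ∘ dI₁ u)
    (hI₁ : ∀ u, dI₁ u = 0 ↔ ∃ w, dI₀ w = u) (hI₂ : ∀ u, dI₂ u = 0 ↔ ∃ w, dI₁ w = u) :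
    Nonempty (Subquotient (LinearMap.range dM₁) (LinearMap.ker dM₂) ≃ₗ[R]
      Subquotient (LinearMap.range dQ₀) (LinearMap.ker dQ₁)) := by
  have hπi : ∀ {ι : Type} (u : ι → M), π ∘ (i ∘ u) = 0 := fun u =>
    funext fun j => (hex _).2 ⟨u j, rfl⟩
  have hlift : ∀ {ι : Type} (u : ι → I), π ∘ u = 0 → ∃ z : ι → M, i ∘ z = u := fun u hu => by
    choose z hz using fun j => (hex (u j)).1 (congrFun hu j)
    exact ⟨z, funext hz⟩
  have hsurj : ∀ {ι : Type} (u : ι → Q), ∃ w : ι → I, π ∘ w = u := fun u =>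
    ⟨fun j => (hπ (u j)).choose, funext fun j => (hπ (u j)).choose_spec⟩
  have hinj : ∀ {ι : Type} {u v : ι → M}, i ∘ u = i ∘ v → u = v := fun h =>
    funext fun j => hi (congrFun h j)
  let W : Submodule R ((ι₂ → M) × (ι₁ → I)) :=
    LinearMap.eqLocus ((i.compLeft ι₂) ∘ₗ LinearMap.fst R _ _) (dI₁ ∘ₗ LinearMap.snd R _ _)
  have hW : ∀ w : W, i ∘ w.1.1 = dI₁ w.1.2 := fun w => w.2
  refine Subquotient.nonempty_equiv (W := W) (LinearMap.fst R _ _ ∘ₗ W.subtype)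
    ((π.compLeft ι₁) ∘ₗ LinearMap.snd R _ _ ∘ₗ W.subtype) (fun w => ?_) (fun w => ?_)
    (fun z hz => ?_) (fun z hz => ?_) (fun w => ?_)
  · apply hinj
    rw [← hi₂]
    change dI₂ (i ∘ w.1.1) = _
    rw [hW, (hI₂ _).2 ⟨_, rfl⟩]
    funext j; simp
  · change dQ₁ (π ∘ w.1.2) = 0
    rw [hπ₁, ← hW, hπi]
  · obtain ⟨w, hw⟩ := (hI₂ (i ∘ z)).1 (by
      rw [hi₂, LinearMap.mem_ker.1 hz]; funext j; simp)
    exact ⟨⟨(z, w), hw.symm⟩, by simp⟩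
  · obtain ⟨w, rfl⟩ := hsurj z
    obtain ⟨m, hm⟩ := hlift (dI₁ w) (by rw [← hπ₁]; exact hz)
    refine ⟨⟨(m, w), hm⟩, ?_⟩
    change π ∘ w - π ∘ w ∈ _
    simp
  · change w.1.1 ∈ LinearMap.range dM₁ ↔ π ∘ w.1.2 ∈ LinearMap.range dQ₀
    constructor
    · rintro ⟨m, hm⟩
      obtain ⟨u, hu⟩ := (hI₁ (w.1.2 - i ∘ m)).1 (by rw [map_sub, ← hW, hi₁, hm, sub_self])
      refine ⟨π ∘ u, ?_⟩
      rw [hπ₀, hu]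
      funext j
      simp [show π (i (m j)) = 0 from congrFun (hπi m) j]
    · rintro ⟨u, hu⟩
      obtain ⟨u, rfl⟩ := hsurj u
      rw [hπ₀] at hu
      obtain ⟨m, hm⟩ := hlift (w.1.2 - dI₀ u) (by
        funext j; simp [show π (dI₀ u j) = π (w.1.2 j) from congrFun hu j])
      refine ⟨m, hinj ?_⟩
      rw [hW, ← hi₁, hm, map_sub, (hI₁ _).2 ⟨u, rfl⟩, sub_zero]

end DimensionShift

/-! ### Coinduced representations -/

namespace Representation

variable {R G M : Type} [CommRing R] [Group G] [AddCommGroup M] [Module R M]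

/-- The coinduced representation on functions `G → M`, by right translation. -/
def funRep (R G M : Type) [CommRing R] [Group G] [AddCommGroup M] [Module R M] :
    Representation R G (G → M) where
  toFun x := LinearMap.funLeft R M (· * x)
  map_one' := by ext; simp [LinearMap.funLeft_apply]
  map_mul' x y := by ext; simp [LinearMap.funLeft_apply, mul_assoc]

@[simp] theorem funRep_apply (x y : G) (f : G → M) : funRep R G M x f y = f (y * x) := rfl

variable (ρ : Representation R G M)

/-- The embedding of a representation into the coinduced one. -/
def orbitMap : M →ₗ[R] (G → M) := LinearMap.pi fun x => ρ x

@[simp] theorem orbitMap_apply (m : M) (x : G) : ρ.orbitMap m x = ρ x m := rfl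

theorem orbitMap_injective : Function.Injective ρ.orbitMap := fun a b h => by
  simpa using congrFun h 1

theorem funRep_orbitMap (x : G) (m : M) : funRep R G M x (ρ.orbitMap m) = ρ.orbitMap (ρ x m) := by
  ext y; simp

/-- The cokernel of the embedding of a representation into the coinduced one. -/
abbrev OrbitCoker : Type := (G → M) ⧸ LinearMap.range ρ.orbitMap

theorem range_orbitMap_le (x : G) : LinearMap.range ρ.orbitMap ≤
    (LinearMap.range ρ.orbitMap).comap (funRep R G M x) := by
  rintro _ ⟨m, rfl⟩
  exact ⟨ρ x m, (ρ.funRep_orbitMap x m).symm⟩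

/-- The representation on the cokernel of the embedding into the coinduced representation. -/
def orbitCokerRep : Representation R G ρ.OrbitCoker where
  toFun x := Submodule.mapQ _ _ (funRep R G M x) (ρ.range_orbitMap_le x)
  map_one' := by ext; simp
  map_mul' x y := by ext; simp

theorem orbitCokerRep_mkQ (x : G) (f : G → M) :
    ρ.orbitCokerRep x ((LinearMap.range ρ.orbitMap).mkQ f) =
      (LinearMap.range ρ.orbitMap).mkQ (funRep R G M x f) := rfl

/-! ### Inhomogeneous cochains -/

/-- The differential on inhomogeneous cochains. -/
def cochainD (q : ℕ) : ((Fin q → G) → M) →ₗ[R] ((Fin (q + 1) → G) → M) :=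
  LinearMap.pi fun g : Fin (q + 1) → G =>
    (ρ (g 0)).comp (LinearMap.proj (fun i => g i.succ)) +
    ∑ j : Fin (q + 1),
      ((-1 : ℤ) ^ ((j : ℕ) + 1)) • LinearMap.proj (Fin.contractNth j (· * ·) g)

theorem cochainD_apply (q : ℕ) (u : (Fin q → G) → M) (g : Fin (q + 1) → G) :
    ρ.cochainD q u g = ρ (g 0) (u fun i => g i.succ) +
      ∑ j : Fin (q + 1), ((-1 : ℤ) ^ ((j : ℕ) + 1)) • u (Fin.contractNth j (· * ·) g) := by
  simp [cochainD]

/-- The differential on inhomogeneous cochains entering degree `q` (zero for `q = 0`). -/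
def cochainDpre : ∀ q : ℕ, ((Fin (q - 1) → G) → M) →ₗ[R] ((Fin q → G) → M)
  | 0 => 0
  | (q + 1) => ρ.cochainD q

theorem cochainD_cochainD (q : ℕ) (u : (Fin q → G) → M) :
    ρ.cochainD (q + 1) (ρ.cochainD q u) = 0 := by
  have key (p : ℕ) (v : (Fin p → G) → M) :
      (inhomogeneousCochains.d (Rep.of ρ) p).hom v = ρ.cochainD p v := by
    funext g
    rw [cochainD_apply]
    refine congrArg₂ _ rfl (Finset.sum_congr rfl fun j _ => ?_)
    rcases neg_one_pow_eq_or ℤ ((j : ℕ) + 1) with h | h <;>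
    rcases Nat.even_or_odd ((j : ℕ) + 1) with h' | h' <;> simp [h'.neg_one_pow]
  have h := congrArg (fun f => f.hom u) (groupCohomology.inhomogeneousCochains.d_comp_d (Rep.of ρ) (n := q))
  rw [← key, ← key]
  exact h

theorem cochainD_comp {M' : Type} [AddCommGroup M'] [Module R M'] (σ : Representation R G M')
    (f : M →ₗ[R] M') (hf : ∀ x m, σ x (f m) = f (ρ x m)) (q : ℕ) (u : (Fin q → G) → M) :
    σ.cochainD q (f ∘ u) = f ∘ ρ.cochainD q u := by
  funext g
  simp [cochainD_apply, hf, map_sum]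

/-- Cohomology of coinduced representations vanishes in positive degrees. -/
theorem exists_cochainD_funRep_eq (q : ℕ) (u : (Fin (q + 1) → G) → (G → M))
    (hu : (funRep R G M).cochainD (q + 1) u = 0) : ∃ w, (funRep R G M).cochainD q w = u := by
  refine ⟨fun g y => u (Fin.cons y g) 1, ?_⟩
  funext g y
  have h := congrFun (congrFun hu (Fin.cons y g)) 1
  rw [cochainD_apply, Fin.sum_univ_succ] at h
  have h0 : Fin.contractNth (0 : Fin (q + 2)) (· * ·) (Fin.cons y g : Fin (q + 2) → G) =
      Fin.cons (y * g 0) fun i => g i.succ := by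
    funext j
    refine Fin.cases ?_ (fun j => ?_) j
    · simp [Fin.contractNth]
    · simp [Fin.contractNth]
  have hs (j : Fin (q + 1)) :
      Fin.contractNth j.succ (· * ·) (Fin.cons y g : Fin (q + 2) → G) =
        Fin.cons y (Fin.contractNth j (· * ·) g) := by
    funext i
    refine Fin.cases ?_ (fun i => ?_) i
    · simp [Fin.contractNth]
    · simp [Fin.contractNth]
  simp only [hs, h0] at h
  rw [cochainD_apply]
  simp [pow_succ] at h ⊢
  rw [← sub_eq_zero, ← neg_eq_zero, ← h]
  abel

end Representation

/-! ### The Koszul differential of a family of endomorphisms -/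

section Koszul

variable {R M : Type} [CommRing R] [AddCommGroup M] [Module R M] {n : ℕ}

/-- Multiplication by `∑ eᵢ ⊗ aᵢ` on functions of finite subsets of `Fin n`. -/
def koszulD (a : Fin n → Module.End R M) :
    (Finset (Fin n) → M) →ₗ[R] (Finset (Fin n) → M) :=
  LinearMap.pi fun σ => ∑ i ∈ σ,
    ((-1 : ℤ) ^ (σ.filter (· < i)).card) • (a i).comp (LinearMap.proj (σ.erase i))

theorem koszulD_apply (a : Fin n → Module.End R M) (u : Finset (Fin n) → M)
    (σ : Finset (Fin n)) :
    koszulD a u σ =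
      ∑ i ∈ σ, ((-1 : ℤ) ^ (σ.filter (· < i)).card) • a i (u (σ.erase i)) := by
  simp [koszulD]

theorem koszulD_congr (a : Fin n → Module.End R M) {u w : Finset (Fin n) → M}
    {σ : Finset (Fin n)} (h : ∀ i ∈ σ, u (σ.erase i) = w (σ.erase i)) :
    koszulD a u σ = koszulD a w σ := by
  simp only [koszulD_apply]
  exact Finset.sum_congr rfl fun i hi => by rw [h i hi]

theorem koszul_sign_swap {σ : Finset (Fin n)} {i j : Fin n} (hi : i ∈ σ) (hij : i < j) :
    (-1 : ℤ) ^ ((σ.erase i).filter (· < j)).card * (-1 : ℤ) ^ (σ.filter (· < i)).card =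
      -((-1 : ℤ) ^ ((σ.erase j).filter (· < i)).card * (-1 : ℤ) ^ (σ.filter (· < j)).card) := by
  have h1 : (σ.erase j).filter (· < i) = σ.filter (· < i) := by
    ext l
    simp only [Finset.mem_filter, Finset.mem_erase]
    exact ⟨fun h => ⟨h.1.2, h.2⟩, fun h => ⟨⟨(h.2.trans hij).ne, h.1⟩, h.2⟩⟩
  have h2 : (σ.erase i).filter (· < j) = (σ.filter (· < j)).erase i := by
    ext l
    simp only [Finset.mem_filter, Finset.mem_erase, and_assoc]
  have h3 := Finset.card_erase_add_one (Finset.mem_filter.2 ⟨hi, hij⟩ : i ∈ σ.filter (· < j))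
  rw [h1, h2, ← h3, pow_succ]
  ring

theorem koszulD_koszulD (a : Fin n → Module.End R M) (u : Finset (Fin n) → M)
    {σ : Finset (Fin n)} (h : ∀ i ∈ σ, ∀ j ∈ σ, i ≠ j → Commute (a i) (a j)) :
    koszulD a (koszulD a u) σ = 0 := by
  simp only [koszulD_apply, map_sum, map_zsmul, Finset.smul_sum, smul_smul]
  rw [Finset.sum_sigma']
  refine Finset.sum_involution (fun x _ => ⟨x.2, x.1⟩) ?_ ?_ ?_ ?_
  · rintro ⟨i, j⟩ hx
    simp only [Finset.mem_sigma, Finset.mem_erase] at hx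
    obtain ⟨hi, hji, hj⟩ := hx
    have hc : a j (a i (u ((σ.erase i).erase j))) = a i (a j (u ((σ.erase i).erase j))) :=
      congrArg (fun f : Module.End R M => f (u ((σ.erase i).erase j))) (h j hj i hi hji)
    dsimp only
    rw [Finset.erase_right_comm (a := j) (b := i), hc, ← add_smul]
    rcases lt_or_gt_of_ne hji with hlt | hlt
    · have := koszul_sign_swap hj hlt
      rw [mul_comm, mul_comm ((-1 : ℤ) ^ (σ.filter (· < j)).card), this]
      simp
    · have := koszul_sign_swap hi hlt
      rw [mul_comm, this, mul_comm ((-1 : ℤ) ^ (σ.filter (· < j)).card)]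
      simp
  · rintro ⟨i, j⟩ hx _ he
    simp only [Finset.mem_sigma, Finset.mem_erase] at hx
    exact hx.2.1 (congrArg Sigma.fst he)
  · rintro ⟨i, j⟩ hx
    simp only [Finset.mem_sigma, Finset.mem_erase] at hx ⊢
    exact ⟨hx.2.2, hx.2.1.symm, hx.1⟩
  · intros; rfl

theorem koszulD_insert_of_lt (a : Fin n → Module.End R M) (u : Finset (Fin n) → M)
    {τ : Finset (Fin n)} {v : Fin n} (hv : ∀ i ∈ τ, i < v) :
    koszulD a u (insert v τ) =
      koszulD a (fun ρ => u (insert v ρ)) τ + ((-1 : ℤ) ^ τ.card) • a v (u τ) := by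
  have hvτ : v ∉ τ := fun h => lt_irrefl _ (hv v h)
  rw [koszulD_apply, Finset.sum_insert hvτ, Finset.erase_insert hvτ, koszulD_apply, add_comm]
  congr 1
  · refine Finset.sum_congr rfl fun i hi => ?_
    have h1 : (insert v τ).filter (· < i) = τ.filter (· < i) := by
      rw [Finset.filter_insert, if_neg (hv i hi).not_gt]
    rw [h1, Finset.erase_insert_of_ne (hv i hi).ne']
  · have h1 : (insert v τ).filter (· < v) = τ := by
      rw [Finset.filter_insert, if_neg (lt_irrefl v), Finset.filter_true_of_mem hv]
    rw [h1]

variable (Γ : SimpleGraph (Fin n))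

theorem erase_mem_cliqueComplex {σ : Finset (Fin n)} (h : σ ∈ cliqueComplex Γ) (i : Fin n) :
    σ.erase i ∈ cliqueComplex Γ := fun x hx y hy =>
  h x (Finset.mem_of_mem_erase hx) y (Finset.mem_of_mem_erase hy)

theorem insert_mem_cliqueComplex {σ : Finset (Fin n)} (h : σ ∈ cliqueComplex Γ) {v : Fin n}
    (hv : ∀ i ∈ σ, Γ.Adj i v) : insert v σ ∈ cliqueComplex Γ := by
  intro x hx y hy hxy
  rcases Finset.mem_insert.1 hx with hx' | hx' <;> rcases Finset.mem_insert.1 hy with hy' | hy'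
  · exact absurd (hx'.trans hy'.symm) hxy
  · exact hx' ▸ (hv y hy').symm
  · exact hy' ▸ hv x hx'
  · exact h x hx' y hy' hxy

/-- The Koszul complex of a clique complex is exact in positive degrees as soon as each
operator `a v` can be solved for on the common kernel of any set of other operators. -/
theorem exists_koszulD_eq (a : Fin n → Module.End R M)
    (hcomm : ∀ i j, Γ.Adj i j → Commute (a i) (a j))
    (hsolve : ∀ (T : Finset (Fin n)) (v : Fin n) (m : M), v ∉ T →
      (∀ j ∈ T, Γ.Adj j v → a j m = 0) → ∃ f, (∀ j ∈ T, a j f = 0) ∧ a v f = m)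
    (T : Finset (Fin n)) (q : ℕ) (u : Finset (Fin n) → M)
    (hu : ∀ σ ∈ cliqueComplex Γ, σ ⊆ T → σ.card = q + 2 → koszulD a u σ = 0) :
    ∃ w, ∀ σ ∈ cliqueComplex Γ, σ ⊆ T → σ.card = q + 1 → koszulD a w σ = u σ := by
  induction T using Finset.strongInduction generalizing q u with
  | H T ih =>
  rcases T.eq_empty_or_nonempty with rfl | hT
  · refine ⟨0, fun σ _ hσ hc => ?_⟩
    rw [Finset.subset_empty.1 hσ] at hc
    simp at hc
  obtain ⟨v, hvT, hmax⟩ : ∃ v ∈ T, ∀ i ∈ T, i ≤ v := ⟨T.max' hT, T.max'_mem hT, T.le_max'⟩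
  have hlt : ∀ i ∈ T.erase v, i < v := fun i hi =>
    lt_of_le_of_ne (hmax i (Finset.mem_of_mem_erase hi)) (Finset.ne_of_mem_erase hi)
  have hsub : ∀ {σ : Finset (Fin n)}, σ ⊆ T → v ∉ σ → σ ⊆ T.erase v := fun h h' =>
    Finset.subset_erase.2 ⟨h, h'⟩
  let L := (T.erase v).filter (Γ.Adj · v)
  have hLT : L ⊆ T.erase v := Finset.filter_subset _ _
  have hLv : ∀ τ ⊆ L, ∀ i ∈ τ, i < v := fun τ hτ i hi => hlt i (hLT (hτ hi))
  have hins : ∀ τ ∈ cliqueComplex Γ, τ ⊆ L → insert v τ ∈ cliqueComplex Γ := fun τ hτ hL =>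
    insert_mem_cliqueComplex Γ hτ fun i hi => (Finset.mem_filter.1 (hL hi)).2
  have hinsT : ∀ τ ⊆ L, insert v τ ⊆ T := fun τ hL =>
    Finset.insert_subset hvT ((hL.trans hLT).trans (Finset.erase_subset _ _))
  obtain ⟨w₀, hw₀⟩ := ih (T.erase v) (Finset.erase_ssubset hvT) q u fun σ hσ hs =>
    hu σ hσ (hs.trans (Finset.erase_subset _ _))
  let u' := u - koszulD a w₀
  have hu' : ∀ σ ∈ cliqueComplex Γ, σ ⊆ T → σ.card = q + 2 → koszulD a u' σ = 0 := by
    intro σ hσ hs hc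
    rw [map_sub, Pi.sub_apply, hu σ hσ hs hc,
      koszulD_koszulD a _ fun i hi j hj hij => hcomm i j (hσ i hi j hj hij), sub_zero]
  have hu'0 : ∀ σ ∈ cliqueComplex Γ, σ ⊆ T.erase v → σ.card = q + 1 → u' σ = 0 :=
    fun σ hσ hs hc => by
      simp only [u', Pi.sub_apply, hw₀ σ hσ hs hc, sub_self]
  suffices h : ∃ w, ∀ σ ∈ cliqueComplex Γ, σ ⊆ T → σ.card = q + 1 → koszulD a w σ = u' σ by
    obtain ⟨w, hw⟩ := h
    refine ⟨w₀ + w, fun σ hσ hs hc => ?_⟩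
    rw [map_add, Pi.add_apply, hw σ hσ hs hc]
    simp [u']
  let g : Finset (Fin n) → M := fun τ => u' (insert v τ)
  have hg : ∀ τ ∈ cliqueComplex Γ, τ ⊆ L → τ.card = q + 1 → koszulD a g τ = 0 := by
    intro τ hτ hL hc
    have h := hu' (insert v τ) (hins τ hτ hL) (hinsT τ hL) (by
      rw [Finset.card_insert_of_notMem fun h => lt_irrefl _ (hLv τ hL v h), hc])
    rwa [koszulD_insert_of_lt a u' (hLv τ hL), hu'0 τ hτ (hL.trans hLT) hc, map_zero, smul_zero,
      add_zero] at h
  have hsplit : ∀ σ ∈ cliqueComplex Γ, σ ⊆ T → v ∈ σ →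
      ∃ τ ∈ cliqueComplex Γ, τ ⊆ L ∧ σ = insert v τ ∧ σ.card = τ.card + 1 := by
    intro σ hσ hs hv
    refine ⟨σ.erase v, erase_mem_cliqueComplex Γ hσ v, fun i hi => ?_,
      (Finset.insert_erase hv).symm, (Finset.card_erase_add_one hv).symm⟩
    have hi' := Finset.mem_erase.1 hi
    exact Finset.mem_filter.2 ⟨Finset.mem_erase.2 ⟨hi'.1, hs hi'.2⟩, hσ i hi'.2 v hv hi'.1⟩
  rcases q with _ | q
  · obtain ⟨f, hf, hfv⟩ := hsolve (T.erase v) v (g ∅) (Finset.notMem_erase v T) fun j hj hjv => by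
      have h := hg {j} (by
        intro x hx y hy hxy
        rw [Finset.mem_singleton.1 hx, Finset.mem_singleton.1 hy] at hxy
        exact absurd rfl hxy) (Finset.singleton_subset_iff.2 (Finset.mem_filter.2 ⟨hj, hjv⟩))
        (Finset.card_singleton j)
      simpa [koszulD_apply, Finset.filter_singleton] using h
    refine ⟨fun _ => f, fun σ hσ hs hc => ?_⟩
    by_cases hv : v ∈ σ
    · obtain ⟨τ, -, -, rfl, hcτ⟩ := hsplit σ hσ hs hv
      have hτ0 : τ = ∅ := Finset.card_eq_zero.1 (by omega)
      subst hτ0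
      simpa [koszulD_apply, Finset.filter_singleton, g] using hfv
    · rw [hu'0 σ hσ (hsub hs hv) hc, koszulD_apply]
      exact Finset.sum_eq_zero fun i hi => by rw [hf i (hsub hs hv hi), smul_zero]
  · obtain ⟨h, hh⟩ := ih L (hLT.trans_ssubset (Finset.erase_ssubset hvT)) q g hg
    refine ⟨fun σ => if v ∈ σ then h (σ.erase v) else 0, fun σ hσ hs hc => ?_⟩
    by_cases hv : v ∈ σ
    · obtain ⟨τ, hτ, hL, rfl, hcτ⟩ := hsplit σ hσ hs hv
      have hvτ : v ∉ τ := fun h => lt_irrefl _ (hLv τ hL v h)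
      rw [koszulD_insert_of_lt a _ (hLv τ hL), if_neg hvτ, map_zero, smul_zero, add_zero]
      refine Eq.trans ?_ (hh τ hτ hL (by omega))
      refine koszulD_congr a fun i hi => ?_
      rw [if_pos (Finset.mem_insert_self _ _),
        Finset.erase_insert fun h => hvτ (Finset.mem_of_mem_erase h)]
    · rw [hu'0 σ hσ (hsub hs hv) hc, koszulD_apply]
      exact Finset.sum_eq_zero fun i hi => by
        rw [if_neg fun h => hv (Finset.mem_of_mem_erase h), map_zero, smul_zero]

end Koszul

/-! ### Representations of right-angled Artin groups -/

namespace RAAG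

variable {n : ℕ} {Γ : SimpleGraph (Fin n)}

/-- Pairwise commutation along the edges of the graph suffices to define a homomorphism. -/
theorem lift_rels {H : Type} [Group H] (f : Fin n → H)
    (hf : ∀ i j, Γ.Adj i j → Commute (f i) (f j)) :
    ∀ r ∈ raagRels Γ, FreeGroup.lift f r = 1 := by
  rintro _ ⟨i, j, hij, rfl⟩
  simp [(hf i j hij).eq]

theorem commute_of {i j : Fin n} (hij : Γ.Adj i j) :
    Commute (PresentedGroup.of i : RAAG Γ) (PresentedGroup.of j) := by
  have h := PresentedGroup.one_of_mem (rels := raagRels Γ) ⟨i, j, hij, rfl⟩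
  simp only [map_mul, map_inv] at h
  rwa [mul_inv_eq_one, mul_inv_eq_iff_eq_mul] at h

/-- Discrete potentials on a right-angled Artin group: a function invariant under the generators
`j ∈ T` adjacent to `v` is the difference along `v` of a function invariant under all generators in
`T`. -/
theorem exists_potential {M : Type} [AddCommGroup M] (T : Finset (Fin n)) {v : Fin n} (hv : v ∉ T)
    (g : RAAG Γ → M) (hg : ∀ j ∈ T, Γ.Adj j v → ∀ y, g (y * PresentedGroup.of j) = g y) :
    ∃ f : RAAG Γ → M, (∀ j ∈ T, ∀ y, f (y * PresentedGroup.of j) = f y) ∧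
      ∀ y, f (y * PresentedGroup.of v) = f y + g y := by
  let s : Fin n → RAAG Γ := fun i => if i ∈ insert v T then PresentedGroup.of i else 1
  have hs : ∀ i j, Γ.Adj i j → Commute (s i) (s j) := fun i j hij => by
    dsimp only [s]
    split_ifs
    exacts [commute_of hij, Commute.one_right _, Commute.one_left _, Commute.one_right _]
  let r : RAAG Γ →* RAAG Γ := PresentedGroup.toGroup (lift_rels s hs)
  have hr : ∀ i, r (PresentedGroup.of i) = s i := fun i => PresentedGroup.toGroup.of _
  have hs' : ∀ i ∈ insert v T, s i = PresentedGroup.of i := fun i hi => if_pos hi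
  let c : Fin n → RAAG Γ → M := fun i y => if i = v then g y else 0
  let A : Fin n → Equiv.Perm (RAAG Γ × M) := fun i =>
    { toFun := fun x => (x.1 * s i, x.2 + c i x.1)
      invFun := fun x => (x.1 * (s i)⁻¹, x.2 - c i (x.1 * (s i)⁻¹))
      left_inv := fun x => by simp
      right_inv := fun x => by simp }
  have hc : ∀ i j, Γ.Adj i j → ∀ y, c i (y * s j) = c i y := fun i j hij y => by
    dsimp only [c]
    split_ifs with hi
    · subst hi
      by_cases hj : j ∈ T
      · rw [hs' j (Finset.mem_insert_of_mem hj), hg j hj hij.symm]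
      · have : s j = 1 := if_neg fun h => (Finset.mem_insert.1 h).elim hij.ne' hj
        rw [this, mul_one]
    · rfl
  have hA : ∀ i j, Γ.Adj i j → Commute (MulOpposite.op (A i)) (MulOpposite.op (A j)) := by
    intro i j hij
    refine MulOpposite.unop_injective (Equiv.ext fun x => Prod.ext ?_ ?_)
    · simp [A, mul_assoc, (hs i j hij).eq]
    · simp only [MulOpposite.unop_mul, MulOpposite.unop_op, Equiv.Perm.mul_apply, A,
        Equiv.coe_fn_mk, hc i j hij, hc j i hij.symm]
      abel
  let Φ : RAAG Γ →* (Equiv.Perm (RAAG Γ × M))ᵐᵒᵖ := PresentedGroup.toGroup (lift_rels _ hA)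
  have hΦ : ∀ i, Φ (PresentedGroup.of i) = MulOpposite.op (A i) := fun i =>
    PresentedGroup.toGroup.of _
  have hfst : ∀ y x, ((Φ y).unop x).1 = x.1 * r y := by
    let H : Subgroup (RAAG Γ) :=
      { carrier := {y | ∀ x, ((Φ y).unop x).1 = x.1 * r y}
        one_mem' := fun x => by simp
        mul_mem' := fun {y z} hy hz x => by
          rw [map_mul, MulOpposite.unop_mul, Equiv.Perm.mul_apply, hz, hy, map_mul, mul_assoc]
        inv_mem' := fun {y} hy x => by
          have h := hy ((Φ y⁻¹).unop x)
          rw [← Equiv.Perm.mul_apply, ← MulOpposite.unop_mul, ← map_mul, inv_mul_cancel, map_one,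
            MulOpposite.unop_one, Equiv.Perm.one_apply] at h
          rw [map_inv r]
          exact eq_mul_inv_of_mul_eq h.symm }
    intro y
    exact PresentedGroup.generated_by (raagRels Γ) H (fun i x => by rw [hΦ, hr]; rfl) y
  let f : RAAG Γ → M := fun y => ((Φ y).unop (y * (r y)⁻¹, 0)).2
  have hf : ∀ i ∈ insert v T, ∀ y, f (y * PresentedGroup.of i) = f y + c i y := by
    intro i hi y
    have h1 : y * PresentedGroup.of i * (r (y * PresentedGroup.of i))⁻¹ = y * (r y)⁻¹ := by
      rw [map_mul, hr, hs' i hi]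
      group
    have h2 : (Φ y).unop (y * (r y)⁻¹, 0) = (y, f y) := Prod.ext (by simp [hfst]) rfl
    change ((Φ (y * PresentedGroup.of i)).unop (_, 0)).2 = _
    rw [h1, map_mul, MulOpposite.unop_mul, Equiv.Perm.mul_apply, h2, hΦ]
    rfl
  refine ⟨f, fun j hj y => ?_, fun y => ?_⟩
  · rw [hf j (Finset.mem_insert_of_mem hj)]
    dsimp only [c]
    rw [if_neg fun h : j = v => hv (h ▸ hj), add_zero]
  · rw [hf v (Finset.mem_insert_self v T)]
    dsimp only [c]
    rw [if_pos rfl]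

variable {R M : Type} [CommRing R] [AddCommGroup M] [Module R M]
  (ρ : Representation R (RAAG Γ) M)

/-- The operators `vᵢ - 1` on a representation. -/
def op (i : Fin n) : Module.End R M := ρ (PresentedGroup.of i) - 1

theorem op_apply (i : Fin n) (m : M) : op ρ i m = ρ (PresentedGroup.of i) m - m := rfl

theorem commute_op {i j : Fin n} (hij : Γ.Adj i j) : Commute (op ρ i) (op ρ j) :=
  (((commute_of hij).map ρ).sub_left (Commute.one_left _)).sub_right
    ((Commute.one_right _))

theorem forall_eq_of_op_eq_zero {m : M} (h : ∀ i, op ρ i m = 0) (x : RAAG Γ) : ρ x m = m := by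
  let H : Subgroup (RAAG Γ) :=
    { carrier := {x | ρ x m = m}
      one_mem' := by simp
      mul_mem' := fun {x y} hx hy => by
        change ρ (x * y) m = m
        rw [map_mul, Module.End.mul_apply, show ρ y m = m from hy, show ρ x m = m from hx]
      inv_mem' := fun {x} hx => by
        change ρ x⁻¹ m = m
        nth_rw 1 [← show ρ x m = m from hx]
        simp [← Module.End.mul_apply, ← map_mul] }
  exact PresentedGroup.generated_by (raagRels Γ) H (fun i => sub_eq_zero.1 (h i)) x

/-- The term of degree `p` of the Cartan complex with coefficients in `M`. -/
abbrev CliqueCochain (Γ : SimpleGraph (Fin n)) (M : Type) (p : ℕ) : Type :=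
  {I : Finset (Fin n) // I ∈ cliqueComplex Γ ∧ I.card = p} → M

/-- The Cartan differential with coefficients in a representation. -/
def cliqueD (p : ℕ) : CliqueCochain Γ M p →ₗ[R] CliqueCochain Γ M (p + 1) :=
  LinearMap.pi fun J => ∑ i : Fin n,
    if h : i ∈ J.1 ∧ J.1.erase i ∈ cliqueComplex Γ then
      ((-1 : ℤ) ^ (J.1.filter (· < i)).card) •
        ((op ρ i).comp
          (LinearMap.proj
            (⟨J.1.erase i, h.2, by
                rw [Finset.card_erase_of_mem h.1, J.2.2, Nat.add_sub_cancel]⟩ :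
              {I : Finset (Fin n) // I ∈ cliqueComplex Γ ∧ I.card = p})))
    else 0

/-- The Cartan differential entering degree `p` (zero for `p = 0`). -/
def cliqueDpre : ∀ p : ℕ, CliqueCochain Γ M (p - 1) →ₗ[R] CliqueCochain Γ M p
  | 0 => 0
  | (p + 1) => cliqueD ρ p

theorem cliqueD_eq_koszulD (p : ℕ) (u : CliqueCochain Γ M p) (w : Finset (Fin n) → M)
    (h : ∀ I, w I.1 = u I) (J : {I : Finset (Fin n) // I ∈ cliqueComplex Γ ∧ I.card = p + 1}) :
    cliqueD ρ p u J = koszulD (op ρ) w J.1 := by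
  rw [koszulD_apply, cliqueD, LinearMap.pi_apply, LinearMap.sum_apply,
    ← Finset.sum_subset (Finset.subset_univ J.1)]
  · refine Finset.sum_congr rfl fun i hi => ?_
    rw [dif_pos ⟨hi, erase_mem_cliqueComplex Γ J.2.1 i⟩, LinearMap.smul_apply,
      LinearMap.comp_apply, LinearMap.proj_apply, ← h]
  · intro i _ hi
    rw [dif_neg fun h => hi h.1, LinearMap.zero_apply]

/-- Extension of a clique cochain by zero to all finite subsets. -/
def extend {p : ℕ} (u : CliqueCochain Γ M p) (I : Finset (Fin n)) : M :=
  if h : I ∈ cliqueComplex Γ ∧ I.card = p then u ⟨I, h⟩ else 0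

theorem extend_coe {p : ℕ} (u : CliqueCochain Γ M p)
    (I : {I : Finset (Fin n) // I ∈ cliqueComplex Γ ∧ I.card = p}) : extend u I.1 = u I :=
  dif_pos I.2

theorem cliqueD_apply (p : ℕ) (u : CliqueCochain Γ M p)
    (J : {I : Finset (Fin n) // I ∈ cliqueComplex Γ ∧ I.card = p + 1}) :
    cliqueD ρ p u J = koszulD (op ρ) (extend u) J.1 :=
  cliqueD_eq_koszulD ρ p u _ (extend_coe u) J

theorem cliqueD_cliqueD (p : ℕ) (u : CliqueCochain Γ M p) :
    cliqueD ρ (p + 1) (cliqueD ρ p u) = 0 := by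
  funext J
  rw [cliqueD_eq_koszulD ρ (p + 1) _ (koszulD (op ρ) (extend u))
    fun I => (cliqueD_apply ρ p u I).symm]
  exact koszulD_koszulD _ _ fun i hi j hj hij => commute_op ρ (J.2.1 i hi j hj hij)

theorem cliqueD_comp {M' : Type} [AddCommGroup M'] [Module R M']
    (σ : Representation R (RAAG Γ) M') (f : M →ₗ[R] M') (hf : ∀ x m, σ x (f m) = f (ρ x m))
    (p : ℕ) (u : CliqueCochain Γ M p) : cliqueD σ p (f ∘ u) = f ∘ cliqueD ρ p u := by
  funext J
  rw [cliqueD_eq_koszulD σ p _ (f ∘ extend u) fun I => by simp [extend_coe],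
    Function.comp_apply, cliqueD_apply, koszulD_apply, koszulD_apply, map_sum]
  refine Finset.sum_congr rfl fun i _ => ?_
  rw [map_zsmul, op_apply, op_apply, map_sub, Function.comp_apply, hf]

/-- The Cartan complex with coefficients in a coinduced representation is exact in positive
degrees. -/
theorem exists_cliqueD_funRep_eq (p : ℕ) (u : CliqueCochain Γ (RAAG Γ → M) (p + 1))
    (hu : cliqueD (Representation.funRep R (RAAG Γ) M) (p + 1) u = 0) :
    ∃ w, cliqueD (Representation.funRep R (RAAG Γ) M) p w = u := by
  obtain ⟨w, hw⟩ := exists_koszulD_eq Γ (op (Representation.funRep R (RAAG Γ) M))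
    (fun i j => commute_op _) (fun T v m hv hm => by
      obtain ⟨f, hf, hfv⟩ := exists_potential T hv m fun j hj hjv y =>
        sub_eq_zero.1 (congrFun (hm j hj hjv) y)
      exact ⟨f, fun j hj => funext fun y => sub_eq_zero.2 (hf j hj y),
        funext fun y => sub_eq_iff_eq_add'.2 (hfv y)⟩)
    Finset.univ p (extend u) fun σ hσ _ hc => by
      rw [← cliqueD_apply _ _ u ⟨σ, hσ, hc⟩, hu]
      rfl
  refine ⟨fun I => w I.1, funext fun J => ?_⟩
  rw [cliqueD_eq_koszulD _ _ _ w fun _ => rfl, hw J.1 J.2.1 (Finset.subset_univ _) J.2.2,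
    extend_coe]

end RAAG

/-! ### Comparison of group cohomology with the Cartan complex -/

namespace RAAG

variable {n : ℕ} {Γ : SimpleGraph (Fin n)} {R : Type} [CommRing R]

theorem cochain_eq_const {M : Type} (u : (Fin 0 → RAAG Γ) → M) : ∃ m, Function.const _ m = u :=
  ⟨u Fin.elim0, funext fun _ => congrArg u (Subsingleton.elim _ _)⟩

theorem cliqueCochain_eq_const {M : Type} (u : CliqueCochain Γ M 0) : ∃ m, Function.const _ m = u :=
  ⟨u ⟨∅, by simp [cliqueComplex]⟩, funext fun x =>
    congrArg u (Subtype.ext (Finset.card_eq_zero.1 x.2.2).symm)⟩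

section DegreeZero

variable {M : Type} [AddCommGroup M] [Module R M] (ρ : Representation R (RAAG Γ) M)

theorem cochainD_const (m : M) (g : Fin 1 → RAAG Γ) :
    ρ.cochainD 0 (Function.const _ m) g = ρ (g 0) m - m := by
  simp [Representation.cochainD_apply, sub_eq_add_neg]

theorem cliqueD_const (m : M) (i : Fin n)
    (J : {I : Finset (Fin n) // I ∈ cliqueComplex Γ ∧ I.card = 1}) (hJ : J.1 = {i}) :
    cliqueD ρ 0 (Function.const _ m) J = op ρ i m := by
  rw [cliqueD_eq_koszulD ρ 0 (Function.const _ m) (Function.const _ m) fun _ => rfl, hJ]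
  simp [koszulD_apply, Finset.filter_singleton]

theorem singleton_mem_cliqueComplex (i : Fin n) : {i} ∈ cliqueComplex Γ := by
  intro x hx y hy hxy
  rw [Finset.mem_singleton.1 hx, Finset.mem_singleton.1 hy] at hxy
  exact absurd rfl hxy

theorem cliqueD_const_eq_zero_iff (m : M) :
    cliqueD ρ 0 (Function.const _ m) = 0 ↔ ∀ i, op ρ i m = 0 := by
  constructor
  · intro h i
    rw [← cliqueD_const ρ m i ⟨{i}, singleton_mem_cliqueComplex i, Finset.card_singleton i⟩ rfl, h]
    rfl
  · intro h
    funext J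
    obtain ⟨i, hi⟩ := Finset.card_eq_one.1 J.2.2
    rw [cliqueD_const ρ m i J hi, h]
    rfl

theorem cochainD_const_eq_zero_iff (m : M) :
    ρ.cochainD 0 (Function.const _ m) = 0 ↔ ∀ i, op ρ i m = 0 := by
  constructor
  · intro h i
    have := cochainD_const ρ m fun _ => PresentedGroup.of i
    rw [h] at this
    exact this.symm
  · intro h
    funext g
    rw [cochainD_const, forall_eq_of_op_eq_zero ρ h, sub_self]
    rfl

end DegreeZero

theorem mkQ_eq_zero_iff {M : Type} [AddCommGroup M] [Module R M] (ρ : Representation R (RAAG Γ) M)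
    (w : RAAG Γ → M) :
    (LinearMap.range ρ.orbitMap).mkQ w = 0 ↔ w ∈ LinearMap.range ρ.orbitMap :=
  Submodule.Quotient.mk_eq_zero _

theorem nonempty_equiv_zero {M : Type} [AddCommGroup M] [Module R M]
    (ρ : Representation R (RAAG Γ) M) :
    Nonempty (Subquotient (LinearMap.range (ρ.cochainDpre 0)) (LinearMap.ker (ρ.cochainD 0)) ≃ₗ[R]
      Subquotient (LinearMap.range (cliqueDpre ρ 0)) (LinearMap.ker (cliqueD ρ 0))) := by
  let W : Submodule R M := ⨅ i, LinearMap.ker (op ρ i)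
  have hW : ∀ m, m ∈ W ↔ ∀ i, op ρ i m = 0 := fun m => by simp [W, Submodule.mem_iInf]
  refine Subquotient.nonempty_equiv (W := W) (LinearMap.pi (fun _ => W.subtype))
    (LinearMap.pi (fun _ => W.subtype))
    (fun w => (cochainD_const_eq_zero_iff ρ w.1).2 ((hW _).1 w.2))
    (fun w => (cliqueD_const_eq_zero_iff ρ w.1).2 ((hW _).1 w.2))
    (fun z hz => ?_) (fun z hz => ?_) (fun w => ?_)
  · obtain ⟨m, rfl⟩ := cochain_eq_const z
    exact ⟨⟨m, (hW m).2 ((cochainD_const_eq_zero_iff ρ m).1 hz)⟩, 0, funext fun x => by simp⟩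
  · obtain ⟨m, rfl⟩ := cliqueCochain_eq_const z
    exact ⟨⟨m, (hW m).2 ((cliqueD_const_eq_zero_iff ρ m).1 hz)⟩, 0, funext fun x => by simp⟩
  · simp only [Representation.cochainDpre, cliqueDpre, LinearMap.range_zero, Submodule.mem_bot]
    constructor
    · intro h
      exact funext fun x => congrFun h Fin.elim0
    · intro h
      exact funext fun x => congrFun h ⟨∅, by simp [cliqueComplex]⟩

theorem nonempty_equiv_one {M : Type} [AddCommGroup M] [Module R M]
    (ρ : Representation R (RAAG Γ) M) :
    Nonempty (Subquotient (LinearMap.range (ρ.cochainDpre 1)) (LinearMap.ker (ρ.cochainD 1)) ≃ₗ[R]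
      Subquotient (LinearMap.range (cliqueDpre ρ 1)) (LinearMap.ker (cliqueD ρ 1))) := by
  let σ := Representation.funRep R (RAAG Γ) M
  let i := ρ.orbitMap
  have hcC : ∀ q u, σ.cochainD q (i ∘ u) = i ∘ ρ.cochainD q u :=
    ρ.cochainD_comp σ i ρ.funRep_orbitMap
  have hcK : ∀ q (u : CliqueCochain Γ M q), cliqueD σ q (i ∘ u) = i ∘ cliqueD ρ q u :=
    cliqueD_comp ρ σ i ρ.funRep_orbitMap
  have hinj : ∀ {ι : Type} {u v : ι → M}, i ∘ u = i ∘ v → u = v := fun h =>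
    funext fun j => ρ.orbitMap_injective (congrFun h j)
  let constC : (RAAG Γ → M) →ₗ[R] ((Fin 0 → RAAG Γ) → RAAG Γ → M) :=
    LinearMap.pi fun _ => LinearMap.id
  let constK : (RAAG Γ → M) →ₗ[R] CliqueCochain Γ (RAAG Γ → M) 0 :=
    LinearMap.pi fun _ => LinearMap.id
  let W : Submodule R ((((Fin 1 → RAAG Γ) → M) × CliqueCochain Γ M 1) × (RAAG Γ → M)) :=
    LinearMap.eqLocus (i.compLeft _ ∘ₗ LinearMap.fst R _ _ ∘ₗ LinearMap.fst R _ _)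
      (σ.cochainD 0 ∘ₗ constC ∘ₗ LinearMap.snd R _ _) ⊓
    LinearMap.eqLocus (i.compLeft _ ∘ₗ LinearMap.snd R _ _ ∘ₗ LinearMap.fst R _ _)
      (cliqueD σ 0 ∘ₗ constK ∘ₗ LinearMap.snd R _ _)
  have hWC : ∀ w : W, i ∘ w.1.1.1 = σ.cochainD 0 (Function.const _ w.1.2) := fun w => w.2.1
  have hWK : ∀ w : W, i ∘ w.1.1.2 = cliqueD σ 0 (Function.const _ w.1.2) := fun w => w.2.2
  refine Subquotient.nonempty_equiv (W := W)
    (LinearMap.fst R _ _ ∘ₗ LinearMap.fst R _ _ ∘ₗ W.subtype)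
    (LinearMap.snd R _ _ ∘ₗ LinearMap.fst R _ _ ∘ₗ W.subtype)
    (fun w => ?_) (fun w => ?_) (fun z hz => ?_) (fun z hz => ?_) (fun w => ?_)
  · apply hinj
    rw [← hcC]
    change σ.cochainD 1 (i ∘ w.1.1.1) = _
    rw [hWC, σ.cochainD_cochainD]
    funext j; simp
  · apply hinj
    rw [← hcK]
    change cliqueD σ 1 (i ∘ w.1.1.2) = _
    rw [hWK, cliqueD_cliqueD]
    funext j; simp
  · obtain ⟨w, hw⟩ := Representation.exists_cochainD_funRep_eq (R := R) 0 (i ∘ z) (by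
      rw [hcC, LinearMap.mem_ker.1 hz]; funext j; simp)
    obtain ⟨w, rfl⟩ := cochain_eq_const w
    have h : ∀ J, ∃ m, i m = cliqueD σ 0 (Function.const _ w) J := fun J => by
      obtain ⟨j, hj⟩ := Finset.card_eq_one.1 J.2.2
      refine ⟨z fun _ => PresentedGroup.of j, ?_⟩
      rw [cliqueD_const σ w j J hj]
      have := congrFun hw fun _ => PresentedGroup.of j
      rw [cochainD_const] at this
      exact this.symm
    choose κ hκ using h
    exact ⟨⟨((z, κ), w), hw.symm, funext hκ⟩, by simp⟩
  · obtain ⟨w, hw⟩ := exists_cliqueD_funRep_eq (R := R) 0 (i ∘ z) (by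
      rw [hcK, LinearMap.mem_ker.1 hz]; funext j; simp)
    obtain ⟨w, rfl⟩ := cliqueCochain_eq_const w
    have hinv := forall_eq_of_op_eq_zero ρ.orbitCokerRep
      (m := (LinearMap.range ρ.orbitMap).mkQ w) fun j => by
        rw [op_apply, Representation.orbitCokerRep_mkQ, ← map_sub, mkQ_eq_zero_iff]
        refine ⟨z ⟨{j}, singleton_mem_cliqueComplex j, Finset.card_singleton j⟩, ?_⟩
        have := congrFun hw ⟨{j}, singleton_mem_cliqueComplex j, Finset.card_singleton j⟩
        rw [cliqueD_const _ w j _ rfl] at this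
        exact this.symm
    have h : ∀ g, ∃ m, i m = σ.cochainD 0 (Function.const _ w) g := fun g => by
      rw [cochainD_const]
      refine (mkQ_eq_zero_iff ρ _).1 ?_
      rw [map_sub, ← Representation.orbitCokerRep_mkQ, hinv, sub_self]
    choose c hc using h
    exact ⟨⟨((c, z), w), funext hc, hw.symm⟩, by simp⟩
  · change w.1.1.1 ∈ LinearMap.range (ρ.cochainD 0) ↔ w.1.1.2 ∈ LinearMap.range (cliqueD ρ 0)
    have key : ∀ m : M, ρ.cochainD 0 (Function.const _ m) = w.1.1.1 ↔
        cliqueD ρ 0 (Function.const _ m) = w.1.1.2 := fun m => by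
      have hC : ρ.cochainD 0 (Function.const _ m) = w.1.1.1 ↔
          σ.cochainD 0 (Function.const _ (i m - w.1.2)) = 0 := by
        rw [show Function.const (Fin 0 → RAAG Γ) (i m - w.1.2) =
          i ∘ Function.const _ m - Function.const _ w.1.2 from rfl, map_sub, ← hWC, hcC,
          sub_eq_zero]
        exact ⟨fun h => by rw [h], hinj⟩
      have hK : cliqueD ρ 0 (Function.const _ m) = w.1.1.2 ↔
          cliqueD σ 0 (Function.const _ (i m - w.1.2)) = 0 := by
        rw [show (Function.const _ (i m - w.1.2) : CliqueCochain Γ (RAAG Γ → M) 0) =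
          i ∘ Function.const _ m - Function.const _ w.1.2 from rfl, map_sub, ← hWK, hcK,
          sub_eq_zero]
        exact ⟨fun h => by rw [h], hinj⟩
      rw [hC, hK, cochainD_const_eq_zero_iff, cliqueD_const_eq_zero_iff]
    constructor
    · rintro ⟨u, hu⟩
      obtain ⟨m, rfl⟩ := cochain_eq_const u
      exact ⟨_, (key m).1 hu⟩
    · rintro ⟨u, hu⟩
      obtain ⟨m, rfl⟩ := cliqueCochain_eq_const u
      exact ⟨_, (key m).2 hu⟩

/-- The cohomology of a right-angled Artin group is computed by the Cartan complex with
coefficients in the representation. -/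
theorem nonempty_cohomology_equiv (q : ℕ) {M : Type} [AddCommGroup M] [Module R M]
    (ρ : Representation R (RAAG Γ) M) :
    Nonempty (Subquotient (LinearMap.range (ρ.cochainDpre q)) (LinearMap.ker (ρ.cochainD q)) ≃ₗ[R]
      Subquotient (LinearMap.range (cliqueDpre ρ q)) (LinearMap.ker (cliqueD ρ q))) := by
  induction q generalizing M with
  | zero => exact nonempty_equiv_zero ρ
  | succ q ih =>
    rcases q with _ | q
    · exact nonempty_equiv_one ρ
    let σ := Representation.funRep R (RAAG Γ) M
    let π := (LinearMap.range ρ.orbitMap).mkQ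
    obtain ⟨e⟩ := ih ρ.orbitCokerRep
    obtain ⟨eC⟩ := nonempty_equiv_of_exact ρ.orbitMap π ρ.orbitMap_injective
      (Submodule.mkQ_surjective _) (mkQ_eq_zero_iff ρ)
      (ρ.cochainD (q + 1)) (ρ.cochainD (q + 2)) (σ.cochainD q) (σ.cochainD (q + 1))
      (σ.cochainD (q + 2)) (ρ.orbitCokerRep.cochainD q) (ρ.orbitCokerRep.cochainD (q + 1))
      (ρ.cochainD_comp σ _ ρ.funRep_orbitMap _) (ρ.cochainD_comp σ _ ρ.funRep_orbitMap _)
      (σ.cochainD_comp _ π ρ.orbitCokerRep_mkQ _) (σ.cochainD_comp _ π ρ.orbitCokerRep_mkQ _)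
      (fun u => ⟨Representation.exists_cochainD_funRep_eq q u, by
        rintro ⟨w, rfl⟩; exact σ.cochainD_cochainD q w⟩)
      (fun u => ⟨Representation.exists_cochainD_funRep_eq (q + 1) u, by
        rintro ⟨w, rfl⟩; exact σ.cochainD_cochainD (q + 1) w⟩)
    obtain ⟨eK⟩ := nonempty_equiv_of_exact ρ.orbitMap π ρ.orbitMap_injective
      (Submodule.mkQ_surjective _) (mkQ_eq_zero_iff ρ)
      (cliqueD ρ (q + 1)) (cliqueD ρ (q + 2)) (cliqueD σ q) (cliqueD σ (q + 1))
      (cliqueD σ (q + 2)) (cliqueD ρ.orbitCokerRep q) (cliqueD ρ.orbitCokerRep (q + 1))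
      (cliqueD_comp ρ σ _ ρ.funRep_orbitMap _) (cliqueD_comp ρ σ _ ρ.funRep_orbitMap _)
      (cliqueD_comp σ _ π ρ.orbitCokerRep_mkQ _) (cliqueD_comp σ _ π ρ.orbitCokerRep_mkQ _)
      (fun u => ⟨exists_cliqueD_funRep_eq q u, by
        rintro ⟨w, rfl⟩; exact cliqueD_cliqueD σ q w⟩)
      (fun u => ⟨exists_cliqueD_funRep_eq (q + 1) u, by
        rintro ⟨w, rfl⟩; exact cliqueD_cliqueD σ (q + 1) w⟩)
    exact ⟨eC ≪≫ₗ e ≪≫ₗ eK.symm⟩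

end RAAG

/-! ### The Laurent ring as a localization -/

section Localization

variable {n : ℕ}

/-- The multiplicative set generated by `t₁ + 1, …, tₙ + 1`. -/
def shiftedVars (k : Type) [Field k] (n : ℕ) : Submonoid (polyRing k n) :=
  Submonoid.closure (Set.range fun i => MvPolynomial.X i + 1)

theorem algebraMap_X (i : Fin n) :
    algebraMap (polyRing k n) (LaurentRing k n) (MvPolynomial.X i) =
      AddMonoidAlgebra.single (Pi.single i 1) 1 - 1 := by
  change phiS k id (MvPolynomial.X i) = _
  simp [phiS]

theorem algebraMap_X_add_one (i : Fin n) :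
    algebraMap (polyRing k n) (LaurentRing k n) (MvPolynomial.X i + 1) =
      AddMonoidAlgebra.single (Pi.single i 1) 1 := by
  rw [map_add, map_one, algebraMap_X, sub_add_cancel]

theorem algebraMap_C (c : k) :
    algebraMap (polyRing k n) (LaurentRing k n) (MvPolynomial.C c) =
      AddMonoidAlgebra.single 0 c := by
  change phiS k id (MvPolynomial.C c) = _
  simp [phiS]

theorem isUnit_algebraMap_of_mem_shiftedVars {s : polyRing k n} (hs : s ∈ shiftedVars k n) :
    IsUnit (algebraMap (polyRing k n) (LaurentRing k n) s) := by
  have h : shiftedVars k n ≤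
      (IsUnit.submonoid (LaurentRing k n)).comap (algebraMap (polyRing k n) (LaurentRing k n)) := by
    refine Submonoid.closure_le.2 ?_
    rintro _ ⟨i, rfl⟩
    change IsUnit (algebraMap (polyRing k n) (LaurentRing k n) _)
    rw [algebraMap_X_add_one]
    refine IsUnit.of_mul_eq_one (AddMonoidAlgebra.single (-Pi.single i 1) 1) ?_
    rw [AddMonoidAlgebra.single_mul_single]
    simp [AddMonoidAlgebra.one_def]
  exact h hs

/-- The monomial in the `tᵢ + 1` with the given exponents. -/
def shiftedMonomial (a : Fin n → ℕ) : polyRing k n := ∏ i, (MvPolynomial.X i + 1) ^ a i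

theorem shiftedMonomial_mem (a : Fin n → ℕ) : shiftedMonomial k a ∈ shiftedVars k n :=
  Submonoid.prod_mem _ fun i _ => pow_mem (Submonoid.subset_closure (Set.mem_range_self i)) _

theorem algebraMap_shiftedMonomial (a : Fin n → ℕ) :
    algebraMap (polyRing k n) (LaurentRing k n) (shiftedMonomial k a) =
      AddMonoidAlgebra.single (fun i => (a i : ℤ)) 1 := by
  have hprod : ∀ (s : Finset (Fin n)) (f : Fin n → Fin n → ℤ),
      ∏ i ∈ s, (AddMonoidAlgebra.single (f i) 1 : LaurentRing k n) =
        AddMonoidAlgebra.single (∑ i ∈ s, f i) 1 := by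
    intro s f
    induction s using Finset.induction_on with
    | empty => simp [AddMonoidAlgebra.one_def]
    | insert i s hi ih =>
      rw [Finset.prod_insert hi, Finset.sum_insert hi, ih, AddMonoidAlgebra.single_mul_single,
        one_mul]
  simp only [shiftedMonomial, map_prod, map_pow, algebraMap_X_add_one,
    AddMonoidAlgebra.single_pow, one_pow, hprod]
  congr 1
  funext j
  simp [Finset.sum_apply, Pi.single_apply]

theorem exists_mul_algebraMap_eq (z : LaurentRing k n) :
    ∃ s ∈ shiftedVars k n, ∃ x, z * algebraMap (polyRing k n) (LaurentRing k n) s =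
      algebraMap (polyRing k n) (LaurentRing k n) x := by
  induction z using AddMonoidAlgebra.induction_linear with
  | zero => exact ⟨1, one_mem _, 0, by simp⟩
  | add f g hf hg =>
    obtain ⟨s, hs, x, hx⟩ := hf
    obtain ⟨t, ht, y, hy⟩ := hg
    refine ⟨s * t, mul_mem hs ht, x * t + y * s, ?_⟩
    simp only [map_mul, map_add, ← hx, ← hy]
    ring
  | single v c =>
    refine ⟨shiftedMonomial k fun i => (-v i).toNat, shiftedMonomial_mem k _,
      MvPolynomial.C c * shiftedMonomial k fun i => (v i).toNat, ?_⟩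
    rw [map_mul, algebraMap_C, algebraMap_shiftedMonomial, algebraMap_shiftedMonomial,
      AddMonoidAlgebra.single_mul_single, AddMonoidAlgebra.single_mul_single, zero_add]
    congr 1
    funext i
    simp only [Pi.add_apply]
    omega

theorem algebraMap_laurentRing_injective :
    Function.Injective (algebraMap (polyRing k n) (LaurentRing k n)) := by
  let ι : (Fin n →₀ ℕ) →+ (Fin n → ℤ) :=
    { toFun := fun a i => a i
      map_zero' := by ext; simp
      map_add' := fun a b => by ext; simp }
  have hι : Function.Injective ι := fun a b h => by
    ext i
    exact Int.ofNat.inj (congrFun h i)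
  let ψ : polyRing k n →+* LaurentRing k n := AddMonoidAlgebra.mapDomainRingHom k ι
  have hψ : Function.Injective ψ := AddMonoidAlgebra.mapDomain_injective hι
  let τ : polyRing k n →ₐ[k] polyRing k n := MvPolynomial.aeval fun i => MvPolynomial.X i - 1
  let τ' : polyRing k n →ₐ[k] polyRing k n := MvPolynomial.aeval fun i => MvPolynomial.X i + 1
  have hτ : Function.LeftInverse τ' τ := by
    have : τ'.comp τ = AlgHom.id k _ := MvPolynomial.algHom_ext fun i => by simp [τ, τ']
    exact fun x => congrArg (fun f : polyRing k n →ₐ[k] polyRing k n => f x) this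
  have h : algebraMap (polyRing k n) (LaurentRing k n) = ψ.comp τ.toRingHom := by
    refine MvPolynomial.ringHom_ext (fun c => ?_) fun i => ?_
    · rw [algebraMap_C]
      have : ψ (MvPolynomial.C c) = AddMonoidAlgebra.single (ι 0) c :=
        AddMonoidAlgebra.mapDomain_single
      simp [τ, MvPolynomial.algebraMap_eq, this]
    · rw [algebraMap_X]
      have : ψ (MvPolynomial.X i) = AddMonoidAlgebra.single (ι (Finsupp.single i 1)) 1 :=
        AddMonoidAlgebra.mapDomain_single
      have hi : ι (Finsupp.single i 1) = Pi.single i 1 := by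
        funext j
        simp [ι, Finsupp.single_apply, Pi.single_apply, eq_comm]
      simp [τ, this, hi]
  rw [h]
  exact hψ.comp hτ.injective

instance isLocalization_laurentRing :
    IsLocalization (shiftedVars k n) (LaurentRing k n) := by
  refine (isLocalization_iff _ _).2 ⟨fun s => isUnit_algebraMap_of_mem_shiftedVars k s.2,
    fun z => ?_, fun {x y} h => ⟨1, by rw [algebraMap_laurentRing_injective k h]⟩⟩
  obtain ⟨s, hs, x, hx⟩ := exists_mul_algebraMap_eq k z
  exact ⟨(x, ⟨s, hs⟩), hx⟩

end Localization

/-! ### Localization of subquotients -/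

section LocalizedSubquotient

variable {S A : Type} [CommRing S] [CommRing A] [Algebra S A] (W : Submonoid S)
  [IsLocalization W A] {X₀ X₁ X₂ Y₀ Y₁ Y₂ : Type}
  [AddCommGroup X₀] [Module S X₀] [AddCommGroup X₁] [Module S X₁] [AddCommGroup X₂] [Module S X₂]
  [AddCommGroup Y₀] [Module S Y₀] [Module A Y₀] [IsScalarTower S A Y₀]
  [AddCommGroup Y₁] [Module S Y₁] [Module A Y₁] [IsScalarTower S A Y₁]
  [AddCommGroup Y₂] [Module S Y₂] [Module A Y₂] [IsScalarTower S A Y₂]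

/-- Cohomology commutes with localization. -/
theorem Subquotient.nonempty_tensor_equiv (f₀ : X₀ →ₗ[S] Y₀) (f₁ : X₁ →ₗ[S] Y₁) (f₂ : X₂ →ₗ[S] Y₂)
    (d₀ : X₀ →ₗ[S] X₁) (d₁ : X₁ →ₗ[S] X₂) (δ₀ : Y₀ →ₗ[A] Y₁) (δ₁ : Y₁ →ₗ[A] Y₂)
    (h₀ : ∀ x, δ₀ (f₀ x) = f₁ (d₀ x)) (h₁ : ∀ x, δ₁ (f₁ x) = f₂ (d₁ x))
    (hf₀ : ∀ y, ∃ s ∈ W, ∃ x, s • y = f₀ x) (hf₁ : ∀ y, ∃ s ∈ W, ∃ x, s • y = f₁ x)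
    (hi₁ : Function.Injective f₁) (hi₂ : Function.Injective f₂) :
    Nonempty (Subquotient (LinearMap.range δ₀) (LinearMap.ker δ₁) ≃ₗ[A]
      TensorProduct S A (Subquotient (LinearMap.range d₀) (LinearMap.ker d₁))) := by
  have hδ : ∀ (s : S) y, δ₁ (s • y) = s • δ₁ y := fun s y => δ₁.map_smul_of_tower s y
  let g : (X₁ ⧸ LinearMap.range d₀) →ₗ[S] (Y₁ ⧸ LinearMap.range δ₀) :=
    (LinearMap.range d₀).liftQ (((LinearMap.range δ₀).mkQ.restrictScalars S) ∘ₗ f₁) (by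
      rintro _ ⟨x, rfl⟩
      refine (Submodule.Quotient.mk_eq_zero _).2 ⟨f₀ x, h₀ x⟩)
  let F : Subquotient (LinearMap.range d₀) (LinearMap.ker d₁) →ₗ[S]
      Subquotient (LinearMap.range δ₀) (LinearMap.ker δ₁) :=
    { toFun := fun x => ⟨g x.1, by
        obtain ⟨_, x, hx, rfl⟩ := x
        exact ⟨f₁ x, by
          change δ₁ _ = 0
          rw [h₁, LinearMap.mem_ker.1 hx, map_zero], rfl⟩⟩
      map_add' := fun x y => Subtype.ext (map_add g x.1 y.1)
      map_smul' := fun s x => Subtype.ext (map_smul g s x.1) }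
  have hF : IsLocalizedModule W F := by
    refine ⟨fun s => ?_, fun y => ?_, fun {x₁ x₂} hx => ?_⟩
    · rw [← (Algebra.lsmul S (A := A) S _).commutes]
      exact (IsLocalization.map_units A s).map _
    · obtain ⟨_, z, hz, rfl⟩ := y
      obtain ⟨s, hs, x, hx⟩ := hf₁ z
      refine ⟨(⟨(LinearMap.range d₀).mkQ x, x, ?_, rfl⟩, ⟨s, hs⟩), Subtype.ext ?_⟩
      · refine hi₂ ?_
        rw [← h₁, ← hx, hδ, LinearMap.mem_ker.1 hz, smul_zero, map_zero]
      · change (LinearMap.range δ₀).mkQ (s • z) = (LinearMap.range δ₀).mkQ (f₁ x)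
        rw [hx]
    · have hx' : F (x₁ - x₂) = 0 := by rw [map_sub, hx, sub_self]
      suffices h : ∃ c : W, c • (x₁ - x₂) = 0 by
        obtain ⟨c, hc⟩ := h
        exact ⟨c, by rwa [smul_sub, sub_eq_zero] at hc⟩
      generalize x₁ - x₂ = x at hx'
      obtain ⟨_, x, hx, rfl⟩ := x
      obtain ⟨y, hy⟩ : f₁ x ∈ LinearMap.range δ₀ :=
        (Submodule.Quotient.mk_eq_zero _).1 (congrArg Subtype.val hx')
      obtain ⟨s, hs, w, hw⟩ := hf₀ y
      refine ⟨⟨s, hs⟩, Subtype.ext ?_⟩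
      change (LinearMap.range d₀).mkQ (s • x) = 0
      refine (Submodule.Quotient.mk_eq_zero _).2 ⟨w, hi₁ ?_⟩
      rw [← h₀, ← hw, LinearMap.map_smul f₁, ← hy]
      exact δ₀.map_smul_of_tower s y
  exact ⟨(IsLocalizedModule.isBaseChange W A F).equiv.symm⟩

end LocalizedSubquotient

/-! ### The Cartan complex over the Laurent ring -/

section CartanLaurent

variable {n : ℕ} {Γ : SimpleGraph (Fin n)}

/-- The Laurent ring as a representation over itself. -/
def laurentRep : Representation (LaurentRing k m) G (LaurentRing k m) where
  toFun g := yMul k m (Multiplicative.toAdd (φ g))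
  map_one' := by
    refine LinearMap.ext fun x => ?_
    simp [yMul, ← AddMonoidAlgebra.one_def]
  map_mul' g h := by
    refine LinearMap.ext fun x => ?_
    simp [yMul, ← mul_assoc, AddMonoidAlgebra.single_mul_single]

theorem inhomogCoD_eq (q : ℕ) : inhomogCoD k φ q = (laurentRep k φ).cochainD q := rfl

theorem inhomogCoDpre_eq (q : ℕ) : inhomogCoDpre k φ q = (laurentRep k φ).cochainDpre q := by
  cases q <;> rfl

theorem op_laurentRep (φ : RAAG Γ →* Multiplicative (Fin n → ℤ))
    (hφ : ∀ i : Fin n, φ (PresentedGroup.of i) = Multiplicative.ofAdd (Pi.single i 1)) (i : Fin n)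
    (x : polyRing k n) :
    RAAG.op (laurentRep k φ) i (algebraMap (polyRing k n) (LaurentRing k n) x) =
      algebraMap (polyRing k n) (LaurentRing k n) (MvPolynomial.X i * x) := by
  have h : laurentRep k φ (PresentedGroup.of i) (algebraMap (polyRing k n) (LaurentRing k n) x) =
      AddMonoidAlgebra.single (Multiplicative.toAdd (φ (PresentedGroup.of i))) 1 *
        algebraMap (polyRing k n) (LaurentRing k n) x := rfl
  rw [RAAG.op_apply, h, map_mul, algebraMap_X, hφ, toAdd_ofAdd, sub_mul, one_mul]

theorem cliqueD_laurentRep (φ : RAAG Γ →* Multiplicative (Fin n → ℤ))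
    (hφ : ∀ i : Fin n, φ (PresentedGroup.of i) = Multiplicative.ofAdd (Pi.single i 1)) (p : ℕ)
    (u : cartanTerm k (cliqueComplex Γ) p) :
    RAAG.cliqueD (laurentRep k φ) p ((Algebra.linearMap _ (LaurentRing k n)).compLeft _ u) =
      (Algebra.linearMap _ (LaurentRing k n)).compLeft _ (cartanD k (cliqueComplex Γ) p u) := by
  funext J
  rw [LinearMap.compLeft_apply, Function.comp_apply, Algebra.linearMap_apply]
  simp only [RAAG.cliqueD, cartanD, LinearMap.pi_apply, LinearMap.sum_apply, map_sum]
  refine Finset.sum_congr rfl fun i _ => ?_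
  split_ifs with h
  · simp only [LinearMap.smul_apply, map_zsmul, LinearMap.comp_apply, LinearMap.proj_apply,
      LinearMap.mulLeft_apply, LinearMap.compLeft_apply, Function.comp_apply,
      Algebra.linearMap_apply, op_laurentRep k φ hφ]
  · simp only [LinearMap.zero_apply, map_zero]

theorem nonempty_cliqueCohomology_equiv (φ : RAAG Γ →* Multiplicative (Fin n → ℤ))
    (hφ : ∀ i : Fin n, φ (PresentedGroup.of i) = Multiplicative.ofAdd (Pi.single i 1)) (p : ℕ) :
    Nonempty (Subquotient (LinearMap.range (RAAG.cliqueDpre (laurentRep k φ) p))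
        (LinearMap.ker (RAAG.cliqueD (laurentRep k φ) p)) ≃ₗ[LaurentRing k n]
      TensorProduct (polyRing k n) (LaurentRing k n)
        (cartanCohomology k (cliqueComplex Γ) p)) := by
  have hinj : ∀ ι : Type, Function.Injective
      ((Algebra.linearMap (polyRing k n) (LaurentRing k n)).compLeft ι) := fun ι u v h =>
    funext fun j => algebraMap_laurentRing_injective k (congrFun h j)
  have hsurj : ∀ (ι : Type) [Finite ι] (y : ι → LaurentRing k n), ∃ s ∈ shiftedVars k n, ∃ x,
      s • y = (Algebra.linearMap (polyRing k n) (LaurentRing k n)).compLeft ι x := by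
    intro ι _ y
    obtain ⟨s, hs⟩ := IsLocalization.exist_integer_multiples_of_finite (shiftedVars k n) y
    choose x hx using hs
    exact ⟨s, s.2, x, funext fun j => (hx j).symm⟩
  refine Subquotient.nonempty_tensor_equiv (shiftedVars k n)
    ((Algebra.linearMap (polyRing k n) (LaurentRing k n)).compLeft _)
    ((Algebra.linearMap (polyRing k n) (LaurentRing k n)).compLeft _)
    ((Algebra.linearMap (polyRing k n) (LaurentRing k n)).compLeft _)
    (cartanDpre k (cliqueComplex Γ) p) (cartanD k (cliqueComplex Γ) p) _ _ (fun u => ?_)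
    (cliqueD_laurentRep k φ hφ p) (hsurj _) (hsurj _) (hinj _) (hinj _)
  cases p with
  | zero => exact (map_zero ((Algebra.linearMap (polyRing k n) (LaurentRing k n)).compLeft _)).symm
  | succ p => exact cliqueD_laurentRep k φ hφ p u

theorem nonempty_groupCohomologyLaurent_equiv (φ : RAAG Γ →* Multiplicative (Fin n → ℤ))
    (hφ : ∀ i : Fin n, φ (PresentedGroup.of i) = Multiplicative.ofAdd (Pi.single i 1)) (q : ℕ) :
    Nonempty (groupCohomologyLaurent k φ q ≃ₗ[LaurentRing k n]
      TensorProduct (polyRing k n) (LaurentRing k n)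
        (cartanCohomology k (cliqueComplex Γ) q)) := by
  obtain ⟨e⟩ := RAAG.nonempty_cohomology_equiv q (laurentRep k φ)
  obtain ⟨e'⟩ := nonempty_cliqueCohomology_equiv k φ hφ q
  rw [← inhomogCoDpre_eq, ← inhomogCoD_eq] at e
  exact ⟨e.trans e'⟩

end CartanLaurent

/-- Let `K` be the clique complex of `Γ`, and suppose the
Cartan complex of `K` has cohomology concentrated in degree `d + 1`
(equivalently, `K` is Cohen–Macaulay of dimension `d`), with `F_K` that
cohomology module.  Let `k[ℤⁿ]` be the group algebra of the abelianization
of `G_Γ`, a `G_Γ`-module via `vᵢ ↦ yᵢ`, and an `S`-module via `tᵢ ↦ yᵢ - 1`.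
Then `H^q(G_Γ; k[ℤⁿ]) = 0` for `q ≠ d + 1`, and `H^{d+1}(G_Γ; k[ℤⁿ])` is
isomorphic, as a module over `k[ℤⁿ]`, to `F_K ⊗_S k[ℤⁿ]` (the localization
of `F_K` inverting `t₁ + 1, …, tₙ + 1`). -/
theorem groupCohomology_abelianization_concentrated_iso_FK {n : ℕ}
    (Γ : SimpleGraph (Fin n)) (d : ℕ)
    (hvanish : ∀ p : ℕ, p ≠ d + 1 →
      Subsingleton (cartanCohomology k (cliqueComplex Γ) p))
    (φ : RAAG Γ →* Multiplicative (Fin n → ℤ))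
    (hφ : ∀ i : Fin n, φ (PresentedGroup.of i) =
      Multiplicative.ofAdd (Pi.single i 1)) :
    (∀ q : ℕ, q ≠ d + 1 → Subsingleton (groupCohomologyLaurent k φ q)) ∧
    Nonempty
      (groupCohomologyLaurent k φ (d + 1) ≃ₗ[LaurentRing k n]
        TensorProduct (polyRing k n) (LaurentRing k n)
          (cartanCohomology k (cliqueComplex Γ) (d + 1))) := by
  refine ⟨fun q hq => ?_, nonempty_groupCohomologyLaurent_equiv k φ hφ (d + 1)⟩
  obtain ⟨e⟩ := nonempty_groupCohomologyLaurent_equiv k φ hφ q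
  have := hvanish q hq
  exact e.toEquiv.subsingleton
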